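/- Fix R₁ > R_c, M ≥ 0 and ω₁ ≥ max_{τ∈[0,1]}|ω(τ)| + max_{τ∈[0,1]}|ω′(τ)|. There exists a constant C = C(R₁, M, ω₁), depending on no other parameters, such that: whenever (Ψ, ξ, R) satisfies the water-wave problem with R_c < R ≤ R₁, Ψ_Y ≥ 0 in D_ξ, and |ξ′(X)| ≤ M for all X ∈ ℝ, one has |∇Ψ(X,Y)| ≤ C for all (X,Y) in the closure of D_ξ. -/

import Mathlib

/-- `Omg ω τ = ∫₀^τ ω(s) ds`. -/
noncomputable def Omg (ω : ℝ → ℝ) (τ : ℝ) : ℝ := ∫ s in (0:ℝ)..τ, ω s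

/-- `theta0 ω = √(2 · max_{τ∈[0,1]} Ω(τ))`. -/
noncomputable def theta0 (ω : ℝ → ℝ) : ℝ := Real.sqrt (2 * sSup (Omg ω '' Set.Icc 0 1))

/-- `Rcal ω θ = θ²/2 + ∫₀¹ (θ² − 2Ω(τ))^{−1/2} dτ − Ω(1)`. -/
noncomputable def Rcal (ω : ℝ → ℝ) (θ : ℝ) : ℝ :=
  θ ^ 2 / 2 + (∫ τ in (0:ℝ)..1, 1 / Real.sqrt (θ ^ 2 - 2 * Omg ω τ)) - Omg ω 1

/-- The critical Bernoulli constant `R_c = inf_{θ>θ₀} ℛ(θ)`. -/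
noncomputable def Rc (ω : ℝ → ℝ) : ℝ := sInf (Rcal ω '' Set.Ioi (theta0 ω))

/-- The fluid domain `D_ξ = {(X,Y) : 0 < Y < ξ(X)}`. -/
def fluidDomain (ξ : ℝ → ℝ) : Set (ℝ × ℝ) := {z : ℝ × ℝ | 0 < z.2 ∧ z.2 < ξ z.1}

/-- `Ψ_X`, computed within the closed fluid domain. -/
noncomputable def psiX (ξ : ℝ → ℝ) (Ψ : ℝ × ℝ → ℝ) (z : ℝ × ℝ) : ℝ :=
  fderivWithin ℝ Ψ (closure (fluidDomain ξ)) z (1, 0)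

/-- `Ψ_Y`, computed within the closed fluid domain. -/
noncomputable def psiY (ξ : ℝ → ℝ) (Ψ : ℝ × ℝ → ℝ) (z : ℝ × ℝ) : ℝ :=
  fderivWithin ℝ Ψ (closure (fluidDomain ξ)) z (0, 1)

/-- The water-wave problem (unit flux, unit gravity): `ξ : ℝ → (0,∞)` is `C¹`, `ω` is `C¹` on
`[0,1]`, `Ψ` is `C¹` on the closure of `D_ξ` and `C²` in `D_ξ`, `ΔΨ + ω(Ψ) = 0` in `D_ξ`,
`(1/2)|∇Ψ|² + ξ = R` on the free surface, `Ψ = 1` on the free surface and `Ψ = 0` on the bottom. -/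
def IsWaterWave (ω : ℝ → ℝ) (Ψ : ℝ × ℝ → ℝ) (ξ : ℝ → ℝ) (R : ℝ) : Prop :=
  (∀ X : ℝ, 0 < ξ X) ∧ ContDiff ℝ 1 ξ ∧ ContDiffOn ℝ 1 ω (Set.Icc 0 1) ∧
  ContDiffOn ℝ 1 Ψ (closure (fluidDomain ξ)) ∧ ContDiffOn ℝ 2 Ψ (fluidDomain ξ) ∧
  (∀ z ∈ fluidDomain ξ,
    fderiv ℝ (psiX ξ Ψ) z (1, 0) + fderiv ℝ (psiY ξ Ψ) z (0, 1) + ω (Ψ z) = 0) ∧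
  (∀ X : ℝ, (1/2) * ((psiX ξ Ψ (X, ξ X)) ^ 2 + (psiY ξ Ψ (X, ξ X)) ^ 2) + ξ X = R) ∧
  (∀ X : ℝ, Ψ (X, ξ X) = 1) ∧
  (∀ X : ℝ, Ψ (X, 0) = 0)

open Set Filter Topology

/-- `g` is differentiable near `0` and its derivative has derivative `c` at `0`. -/
def HasSecondDerivAtZero (g : ℝ → ℝ) (c : ℝ) : Prop :=
  ∃ g' : ℝ → ℝ, (∀ᶠ s in 𝓝 (0:ℝ), HasDerivAt g (g' s) s) ∧ HasDerivAt g' c 0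

lemma HasSecondDerivAtZero.sub {f g : ℝ → ℝ} {a b : ℝ} (hf : HasSecondDerivAtZero f a)
    (hg : HasSecondDerivAtZero g b) : HasSecondDerivAtZero (fun s => f s - g s) (a - b) := by
  obtain ⟨f', h1, h2⟩ := hf
  obtain ⟨g', h3, h4⟩ := hg
  refine ⟨fun s => f' s - g' s, ?_, h2.sub h4⟩
  filter_upwards [h1, h3] with s hs ht using hs.sub ht

lemma hasSecondDerivAtZero_quadratic (a b c : ℝ) :
    HasSecondDerivAtZero (fun s => a + b * s + c * s ^ 2) (2 * c) := by
  refine ⟨fun s => b + 2 * c * s, Eventually.of_forall fun s => ?_, ?_⟩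
  · have := (((hasDerivAt_id s).const_mul b).const_add a).add
      (((hasDerivAt_id s).pow 2).const_mul c)
    exact this.congr_deriv (by simp; ring)
  · have := (((hasDerivAt_id (0:ℝ)).const_mul (2 * c)).const_add b)
    exact this.congr_deriv (by simp)

/-- Second-order necessary condition for a local maximum. -/
lemma HasSecondDerivAtZero.nonpos {g : ℝ → ℝ} {c : ℝ} (hg : HasSecondDerivAtZero g c)
    (hmax : IsLocalMax g 0) : c ≤ 0 := by
  obtain ⟨g', h1, h2⟩ := hg
  by_contra! hc
  have he : deriv g =ᶠ[𝓝 0] g' := by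
    filter_upwards [h1] with s hs using hs.deriv
  have hd : deriv (deriv g) 0 = c := by rw [he.deriv_eq]; exact h2.deriv
  have hmin : IsLocalMin g 0 :=
    isLocalMin_of_deriv_deriv_pos (by rw [hd]; exact hc) hmax.deriv_eq_zero
      h1.self_of_nhds.continuousAt
  have hconst : g =ᶠ[𝓝 0] fun _ => g 0 := by
    filter_upwards [hmax, hmin] with s hs ht using le_antisymm hs ht
  have h0 : deriv g =ᶠ[𝓝 0] fun _ => 0 := by simpa using hconst.deriv
  rw [h0.deriv_eq] at hd
  simp at hd
  linarith

/-- First-order necessary condition for a one-sided maximum. -/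
lemma HasDerivWithinAt.nonpos_of_forall_le {g : ℝ → ℝ} {c δ : ℝ} (hδ : 0 < δ)
    (h : HasDerivWithinAt g c (Icc 0 δ) 0) (hmax : ∀ s ∈ Icc 0 δ, g s ≤ g 0) : c ≤ 0 := by
  have h' : HasDerivWithinAt g c (Ioi 0) 0 :=
    h.mono_of_mem_nhdsWithin (mem_of_superset (Ioc_mem_nhdsGT hδ) Ioc_subset_Icc_self)
  rw [hasDerivWithinAt_iff_tendsto_slope' (by simp)] at h'
  refine le_of_tendsto h' ?_
  filter_upwards [Ioc_mem_nhdsGT hδ] with s hs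
  rw [slope_def_field]
  exact div_nonpos_of_nonpos_of_nonneg (by linarith [hmax s ⟨hs.1.le, hs.2⟩]) (by linarith [hs.1])

lemma isOpen_fluidDomain {ξ : ℝ → ℝ} (hξ : Continuous ξ) : IsOpen (fluidDomain ξ) :=
  (isOpen_lt continuous_const continuous_snd).inter
    (isOpen_lt continuous_snd (hξ.comp continuous_fst))

lemma closure_fluidDomain {ξ : ℝ → ℝ} (hξ : Continuous ξ) (hpos : ∀ X, 0 < ξ X) :
    closure (fluidDomain ξ) = {z : ℝ × ℝ | 0 ≤ z.2 ∧ z.2 ≤ ξ z.1} := by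
  apply Subset.antisymm
  · refine closure_minimal (fun z hz => ⟨hz.1.le, hz.2.le⟩) ?_
    exact (isClosed_le continuous_const continuous_snd).inter
      (isClosed_le continuous_snd (hξ.comp continuous_fst))
  · rintro ⟨x, y⟩ ⟨h0, h1⟩
    simp only at h0 h1
    have ht : Tendsto (fun s : ℝ => (x, y + s * (ξ x / 2 - y))) (𝓝[>] 0) (𝓝 (x, y)) := by
      have : Continuous (fun s : ℝ => (x, y + s * (ξ x / 2 - y))) := by fun_prop
      have h := this.tendsto 0
      simp only [zero_mul, add_zero] at h
      exact h.mono_left nhdsWithin_le_nhds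
    refine mem_closure_of_tendsto ht ?_
    filter_upwards [Ioo_mem_nhdsGT (zero_lt_one (α := ℝ))] with s hs
    have hx := hpos x
    have e1 : y + s * (ξ x / 2 - y) = (1 - s) * y + s * (ξ x / 2) := by ring
    have p1 : 0 ≤ (1 - s) * y := mul_nonneg (by linarith [hs.2]) h0
    have p2 : 0 < s * (ξ x / 2) := mul_pos hs.1 (by linarith)
    have p3 : (1 - s) * y ≤ (1 - s) * ξ x := mul_le_mul_of_nonneg_left h1 (by linarith [hs.2])
    constructor
    · simp only [e1]; linarith
    · simp only [e1]; linarith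

/-- The second derivative of `Ψ` at `z` in the direction `d`. -/
noncomputable def psiSecond (ξ : ℝ → ℝ) (Ψ : ℝ × ℝ → ℝ) (z d : ℝ × ℝ) : ℝ :=
  fderiv ℝ (psiX ξ Ψ) z d * d.1 + fderiv ℝ (psiY ξ Ψ) z d * d.2

lemma ContinuousLinearMap.apply_prod_real (f : ℝ × ℝ →L[ℝ] ℝ) (d : ℝ × ℝ) :
    f d = f (1, 0) * d.1 + f (0, 1) * d.2 := by
  have : d = d.1 • ((1, 0) : ℝ × ℝ) + d.2 • ((0, 1) : ℝ × ℝ) := by ext <;> simp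
  conv_lhs => rw [this]
  rw [map_add, map_smul, map_smul]
  simp [mul_comm]

lemma psiSecond_add_psiSecond_rotate (ξ : ℝ → ℝ) (Ψ : ℝ × ℝ → ℝ) (z : ℝ × ℝ) (a b : ℝ) :
    psiSecond ξ Ψ z (a, b) + psiSecond ξ Ψ z (-b, a) =
      (a ^ 2 + b ^ 2) * (fderiv ℝ (psiX ξ Ψ) z (1, 0) + fderiv ℝ (psiY ξ Ψ) z (0, 1)) := by
  unfold psiSecond
  rw [ContinuousLinearMap.apply_prod_real (fderiv ℝ (psiX ξ Ψ) z) (a, b),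
    ContinuousLinearMap.apply_prod_real (fderiv ℝ (psiX ξ Ψ) z) (-b, a),
    ContinuousLinearMap.apply_prod_real (fderiv ℝ (psiY ξ Ψ) z) (a, b),
    ContinuousLinearMap.apply_prod_real (fderiv ℝ (psiY ξ Ψ) z) (-b, a)]
  ring

namespace IsWaterWave

variable {ω : ℝ → ℝ} {Ψ : ℝ × ℝ → ℝ} {ξ : ℝ → ℝ} {R : ℝ}

lemma surface_pos (h : IsWaterWave ω Ψ ξ R) (X : ℝ) : 0 < ξ X := h.1 X

lemma continuous_surface (h : IsWaterWave ω Ψ ξ R) : Continuous ξ := h.2.1.continuous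

lemma mem_closure_iff (h : IsWaterWave ω Ψ ξ R) {z : ℝ × ℝ} :
    z ∈ closure (fluidDomain ξ) ↔ 0 ≤ z.2 ∧ z.2 ≤ ξ z.1 := by
  rw [closure_fluidDomain h.continuous_surface h.1]; rfl

lemma hasDerivWithinAt_line (h : IsWaterWave ω Ψ ξ R) {z d : ℝ × ℝ} {T : Set ℝ} {t : ℝ}
    (ht : t ∈ T) (hT : ∀ s ∈ T, z + s • d ∈ closure (fluidDomain ξ)) :
    HasDerivWithinAt (fun s => Ψ (z + s • d))
      (psiX ξ Ψ (z + t • d) * d.1 + psiY ξ Ψ (z + t • d) * d.2) T t := by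
  have h1 := ((h.2.2.2.1.differentiableOn one_ne_zero) _ (hT t ht)).hasFDerivWithinAt
  have h2 : HasDerivWithinAt (fun s : ℝ => z + s • d) d T t := by
    have := (((hasDerivAt_id t).smul_const d).const_add z).hasDerivWithinAt (s := T)
    simpa using this
  have h3 := h1.comp_hasDerivWithinAt t h2 hT
  rw [ContinuousLinearMap.apply_prod_real] at h3
  exact h3

lemma eventually_mem (h : IsWaterWave ω Ψ ξ R) {z : ℝ × ℝ} (hz : z ∈ fluidDomain ξ)
    (d : ℝ × ℝ) : ∀ᶠ s in 𝓝 (0:ℝ), z + s • d ∈ fluidDomain ξ := by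
  have hc : Continuous (fun s : ℝ => z + s • d) := by fun_prop
  exact hc.continuousAt.eventually_mem
    ((isOpen_fluidDomain h.continuous_surface).mem_nhds (by simpa using hz))

lemma differentiableAt_psi (h : IsWaterWave ω Ψ ξ R) {z : ℝ × ℝ} (hz : z ∈ fluidDomain ξ) :
    DifferentiableAt ℝ (psiX ξ Ψ) z ∧ DifferentiableAt ℝ (psiY ξ Ψ) z := by
  have hopen := isOpen_fluidDomain h.continuous_surface
  have hd : DifferentiableAt ℝ (fderiv ℝ Ψ) z := by
    have h1 : ContDiffAt ℝ 2 Ψ z := h.2.2.2.2.1.contDiffAt (hopen.mem_nhds hz)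
    exact (h1.fderiv_right (m := 1) (by norm_num)).differentiableAt one_ne_zero
  have he : ∀ᶠ w in 𝓝 z, fderivWithin ℝ Ψ (closure (fluidDomain ξ)) w = fderiv ℝ Ψ w := by
    filter_upwards [hopen.mem_nhds hz] with w hw
    exact fderivWithin_of_mem_nhds (mem_of_superset (hopen.mem_nhds hw) subset_closure)
  constructor
  · refine (hd.clm_apply (differentiableAt_const ((1, 0) : ℝ × ℝ))).congr_of_eventuallyEq ?_
    filter_upwards [he] with w hw
    rw [psiX, hw]
  · refine (hd.clm_apply (differentiableAt_const ((0, 1) : ℝ × ℝ))).congr_of_eventuallyEq ?_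
    filter_upwards [he] with w hw
    rw [psiY, hw]

lemma hasSecondDerivAtZero (h : IsWaterWave ω Ψ ξ R) {z : ℝ × ℝ} (hz : z ∈ fluidDomain ξ)
    (d : ℝ × ℝ) : HasSecondDerivAtZero (fun s => Ψ (z + s • d)) (psiSecond ξ Ψ z d) := by
  refine ⟨fun s => psiX ξ Ψ (z + s • d) * d.1 + psiY ξ Ψ (z + s • d) * d.2, ?_, ?_⟩
  · have h0 := h.eventually_mem hz d
    filter_upwards [h0.eventually_nhds] with t ht
    refine (h.hasDerivWithinAt_line (T := {s | z + s • d ∈ fluidDomain ξ}) ht.self_of_nhds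
      fun s hs => subset_closure hs).hasDerivAt ht
  · obtain ⟨h1, h2⟩ := h.differentiableAt_psi hz
    have hl : HasDerivAt (fun s : ℝ => z + s • d) d 0 := by
      have := (((hasDerivAt_id (0:ℝ)).smul_const d).const_add z)
      simpa using this
    have h1' : HasFDerivAt (psiX ξ Ψ) (fderiv ℝ (psiX ξ Ψ) z) (z + (0:ℝ) • d) := by
      simpa using h1.hasFDerivAt
    have h2' : HasFDerivAt (psiY ξ Ψ) (fderiv ℝ (psiY ξ Ψ) z) (z + (0:ℝ) • d) := by
      simpa using h2.hasFDerivAt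
    exact ((h1'.comp_hasDerivAt (0:ℝ) hl).mul_const d.1).add
      ((h2'.comp_hasDerivAt (0:ℝ) hl).mul_const d.2)

lemma psiSecond_add (h : IsWaterWave ω Ψ ξ R) {z : ℝ × ℝ} (hz : z ∈ fluidDomain ξ) (a b : ℝ) :
    psiSecond ξ Ψ z (a, b) + psiSecond ξ Ψ z (-b, a) = -((a ^ 2 + b ^ 2) * ω (Ψ z)) := by
  rw [psiSecond_add_psiSecond_rotate]
  have := h.2.2.2.2.2.1 z hz
  rw [eq_neg_of_add_eq_zero_left this]; ring

lemma psi_mem_Icc (h : IsWaterWave ω Ψ ξ R) (hmono : ∀ z ∈ fluidDomain ξ, 0 ≤ psiY ξ Ψ z)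
    {z : ℝ × ℝ} (hz : z ∈ closure (fluidDomain ξ)) : Ψ z ∈ Icc 0 1 := by
  obtain ⟨x, y⟩ := z
  rw [h.mem_closure_iff] at hz
  simp only at hz
  have hd : ∀ t ∈ Icc 0 (ξ x), HasDerivWithinAt (fun s => Ψ (x, s)) (psiY ξ Ψ (x, t))
      (Icc 0 (ξ x)) t := by
    intro t ht
    have := h.hasDerivWithinAt_line (z := (x, 0)) (d := (0, 1)) (T := Icc 0 (ξ x)) ht
      (fun s hs => by rw [h.mem_closure_iff]; simpa using hs)
    simpa using this
  have hm : MonotoneOn (fun s => Ψ (x, s)) (Icc 0 (ξ x)) := by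
    refine monotoneOn_of_deriv_nonneg (convex_Icc _ _)
      (fun t ht => (hd t ht).continuousWithinAt) ?_ ?_
    · intro t ht
      exact ((hd t (interior_subset ht)).mono interior_subset).differentiableWithinAt
    · intro t ht
      rw [((hd t (interior_subset ht)).hasDerivAt (mem_interior_iff_mem_nhds.1 ht)).deriv]
      rw [interior_Icc] at ht
      exact hmono _ ht
  have hx := (h.surface_pos x).le
  constructor
  · have := hm (left_mem_Icc.2 hx) hz hz.1
    simpa [h.2.2.2.2.2.2.2.2 x] using this
  · have := hm hz (right_mem_Icc.2 hx) hz.2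
    simpa [h.2.2.2.2.2.2.2.1 x] using this

lemma abs_psi_le_of_surface (h : IsWaterWave ω Ψ ξ R) {K : ℝ} (hK : 0 ≤ K)
    (hKR : 2 * R ≤ K ^ 2) (X : ℝ) : |psiX ξ Ψ (X, ξ X)| ≤ K ∧ |psiY ξ Ψ (X, ξ X)| ≤ K := by
  have h1 := h.2.2.2.2.2.2.1 X
  have h2 := h.surface_pos X
  constructor <;> apply abs_le_of_sq_le_sq _ hK <;>
    nlinarith [sq_nonneg (psiX ξ Ψ (X, ξ X)), sq_nonneg (psiY ξ Ψ (X, ξ X))]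

lemma surface_le (h : IsWaterWave ω Ψ ξ R) (X : ℝ) : ξ X ≤ R := by
  have h1 := h.2.2.2.2.2.2.1 X
  nlinarith [sq_nonneg (psiX ξ Ψ (X, ξ X)), sq_nonneg (psiY ξ Ψ (X, ξ X))]

lemma abs_vorticity_le (h : IsWaterWave ω Ψ ξ R) {ω₁ : ℝ}
    (hω : sSup ((fun τ => |ω τ|) '' Set.Icc 0 1)
        + sSup ((fun τ => |derivWithin ω (Set.Icc 0 1) τ|) '' Set.Icc 0 1) ≤ ω₁)
    {τ : ℝ} (hτ : τ ∈ Icc (0:ℝ) 1) : |ω τ| ≤ ω₁ := by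
  have hb : BddAbove ((fun τ => |ω τ|) '' Set.Icc 0 1) :=
    (isCompact_Icc.image_of_continuousOn h.2.2.1.continuousOn.abs).bddAbove
  have h1 := le_csSup hb (mem_image_of_mem _ hτ)
  have h2 : 0 ≤ sSup ((fun τ => |derivWithin ω (Set.Icc 0 1) τ|) '' Set.Icc 0 1) := by
    apply Real.sSup_nonneg
    rintro _ ⟨t, _, rfl⟩
    exact abs_nonneg _
  linarith

/-- Comparison with a quadratic barrier lying above `Ψ` on the free surface. -/
lemma le_barrier (h : IsWaterWave ω Ψ ξ R) (hmono : ∀ z ∈ fluidDomain ξ, 0 ≤ psiY ξ Ψ z)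
    {ω₁ : ℝ} (hω : ∀ τ ∈ Icc (0:ℝ) 1, |ω τ| ≤ ω₁) {α β X₀ : ℝ} (hβ : ω₁ + 2 < 2 * β)
    (hα : β * R ≤ α)
    (hsurf : ∀ X ∈ Icc (X₀ - 1) (X₀ + 1), 1 ≤ α * ξ X - β * ξ X ^ 2 + (X - X₀) ^ 2)
    {X Y : ℝ} (hX : X ∈ Icc (X₀ - 1) (X₀ + 1)) (hY : Y ∈ Icc 0 (ξ X)) :
    Ψ (X, Y) ≤ α * Y - β * Y ^ 2 + (X - X₀) ^ 2 := by
  set S : Set (ℝ × ℝ) := {z | z.1 ∈ Icc (X₀ - 1) (X₀ + 1)} ∩ closure (fluidDomain ξ) with hS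
  have hω₁ : 0 ≤ ω₁ := (abs_nonneg _).trans (hω 0 (by simp))
  have hSc : IsCompact S := by
    refine (isCompact_Icc (a := (X₀ - 1, (0:ℝ))) (b := (X₀ + 1, R))).of_isClosed_subset
      ((isClosed_Icc.preimage continuous_fst).inter isClosed_closure) ?_
    rintro ⟨x, y⟩ ⟨h1, h2⟩
    rw [h.mem_closure_iff] at h2
    simp only [mem_ofPred_eq, Set.mem_Icc] at h1 h2
    have := h.surface_le x
    exact ⟨⟨h1.1, h2.1⟩, ⟨h1.2, h2.2.trans this⟩⟩
  have hXS : (X, Y) ∈ S := ⟨hX, h.mem_closure_iff.2 hY⟩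
  obtain ⟨⟨x, y⟩, hz, hzmax⟩ := hSc.exists_isMaxOn ⟨_, hXS⟩
    (f := fun z : ℝ × ℝ => Ψ z - (α * z.2 - β * z.2 ^ 2 + (z.1 - X₀) ^ 2))
    ((h.2.2.2.1.continuousOn.mono inter_subset_right).sub (by fun_prop))
  have hle := isMaxOn_iff.1 hzmax _ hXS
  suffices Ψ (x, y) - (α * y - β * y ^ 2 + (x - X₀) ^ 2) ≤ 0 by linarith
  by_contra! hpos
  have hz1 : x ∈ Icc (X₀ - 1) (X₀ + 1) := hz.1
  have hz2 : 0 ≤ y ∧ y ≤ ξ x := h.mem_closure_iff.1 hz.2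
  have hΨ := h.psi_mem_Icc hmono hz.2
  have hy0 : 0 < y := by
    refine lt_of_le_of_ne hz2.1 fun h0 => ?_
    rw [← h0, h.2.2.2.2.2.2.2.2 x] at hpos
    nlinarith [sq_nonneg (x - X₀)]
  have hy1 : y < ξ x := by
    refine lt_of_le_of_ne hz2.2 fun h0 => ?_
    rw [h0, h.2.2.2.2.2.2.2.1 x] at hpos
    linarith [hsurf x hz1]
  have hyR : β * y ≤ β * R :=
    mul_le_mul_of_nonneg_left (hz2.2.trans (h.surface_le x)) (by linarith)
  have hside : (x - X₀) ^ 2 < 1 := by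
    have : 0 ≤ (α - β * y) * y := mul_nonneg (by linarith) hy0.le
    nlinarith [hΨ.2]
  have hx0 : X₀ - 1 < x ∧ x < X₀ + 1 := by
    have := abs_lt_of_sq_lt_sq (a := x - X₀) (b := 1) (by simpa using hside) zero_le_one
    rw [abs_lt] at this
    constructor <;> linarith [this.1, this.2]
  have hzD : (x, y) ∈ fluidDomain ξ := ⟨hy0, hy1⟩
  have hnear : ∀ d : ℝ × ℝ, ∀ᶠ s in 𝓝 (0:ℝ), (x, y) + s • d ∈ S := by
    intro d
    have hc : Continuous (fun s : ℝ => ((x, y) + s • d).1) := by fun_prop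
    filter_upwards [h.eventually_mem hzD d, hc.continuousAt.eventually_mem
      (Icc_mem_nhds (a := X₀ - 1) (b := X₀ + 1) (by simpa using hx0.1)
        (by simpa using hx0.2))] with s h1 h2
    exact ⟨h2, subset_closure h1⟩
  have e1 : psiSecond ξ Ψ (x, y) (1, 0) - 2 * 1 ≤ 0 := by
    refine ((h.hasSecondDerivAtZero hzD (1, 0)).sub (hasSecondDerivAtZero_quadratic
      (α * y - β * y ^ 2 + (x - X₀) ^ 2) (2 * (x - X₀)) 1)).nonpos ?_
    filter_upwards [hnear (1, 0)] with s hs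
    have := isMaxOn_iff.1 hzmax _ hs
    simp at this ⊢
    linarith
  have e2 : psiSecond ξ Ψ (x, y) (0, 1) - 2 * (-β) ≤ 0 := by
    refine ((h.hasSecondDerivAtZero hzD (0, 1)).sub (hasSecondDerivAtZero_quadratic
      (α * y - β * y ^ 2 + (x - X₀) ^ 2) (α - 2 * β * y) (-β))).nonpos ?_
    filter_upwards [hnear (0, 1)] with s hs
    have := isMaxOn_iff.1 hzmax _ hs
    simp at this ⊢
    linarith
  have e3 := h.psiSecond_add hzD 1 0
  have e4 := abs_le.1 (hω _ hΨ)
  norm_num at e3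
  linarith [e4.2]

/-- `Ψ` grows at most linearly away from the bottom. -/
lemma le_linear (h : IsWaterWave ω Ψ ξ R) (hmono : ∀ z ∈ fluidDomain ξ, 0 ≤ psiY ξ Ψ z)
    {ω₁ : ℝ} (hω : ∀ τ ∈ Icc (0:ℝ) 1, |ω τ| ≤ ω₁) {K β : ℝ} (hK : 0 ≤ K)
    (hKR : 2 * R ≤ K ^ 2) (hβ : ω₁ + 2 < 2 * β) {z : ℝ × ℝ}
    (hz : z ∈ closure (fluidDomain ξ)) : Ψ z ≤ (K + 2 * β * R) * z.2 := by
  obtain ⟨X₀, Y⟩ := z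
  rw [h.mem_closure_iff] at hz
  simp only at hz ⊢
  have hω₁ : 0 ≤ ω₁ := (abs_nonneg _).trans (hω 0 (by simp))
  have hβ0 : 0 < β := by linarith
  have hR : 0 < R := (h.surface_pos 0).trans_le (h.surface_le 0)
  have hβR : 0 < β * R := mul_pos hβ0 hR
  have hX₀ : X₀ ∈ Icc (X₀ - 1) (X₀ + 1) := by constructor <;> linarith
  obtain ⟨X₁, hX₁, hmax⟩ := (isCompact_Icc (a := X₀ - 1) (b := X₀ + 1)).exists_isMaxOn ⟨X₀, hX₀⟩
    (f := fun X => (1 + β * ξ X ^ 2 - (X - X₀) ^ 2) / ξ X) (by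
      have := h.continuous_surface
      refine Continuous.continuousOn (Continuous.div (by fun_prop) this
        fun X => (h.surface_pos X).ne'))
  set α := (1 + β * ξ X₁ ^ 2 - (X₁ - X₀) ^ 2) / ξ X₁ with hαdef
  have hsurf : ∀ X ∈ Icc (X₀ - 1) (X₀ + 1), 1 ≤ α * ξ X - β * ξ X ^ 2 + (X - X₀) ^ 2 := by
    intro X hX
    have := isMaxOn_iff.1 hmax X hX
    simp only [← hαdef] at this
    rw [div_le_iff₀ (h.surface_pos X)] at this
    linarith
  have hαle : α ≤ K + 2 * β * R := by
    by_contra! hcon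
    have hξ1 := h.surface_pos X₁
    have hbar := fun Y (hY : Y ∈ Icc 0 (ξ X₁)) =>
      h.le_barrier hmono hω hβ (by linarith) hsurf hX₁ hY
    have hd := h.hasDerivWithinAt_line (z := (X₁, ξ X₁)) (d := (0, -1)) (T := Icc 0 (ξ X₁))
      (t := 0) ⟨le_rfl, hξ1.le⟩ (fun s hs => by
        rw [h.mem_closure_iff]; simp only [Set.mem_Icc] at hs
        simp; exact ⟨by linarith [hs.2], hs.1⟩)
    have hq : HasDerivWithinAt (fun s : ℝ => α * (ξ X₁ - s) - β * (ξ X₁ - s) ^ 2)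
        (-α + 2 * β * ξ X₁) (Icc 0 (ξ X₁)) 0 := by
      have h1 : HasDerivAt (fun s : ℝ => ξ X₁ - s) (-1) 0 := by
        simpa using (hasDerivAt_id (0:ℝ)).const_sub (ξ X₁)
      have h2 := ((h1.const_mul α).sub ((h1.pow 2).const_mul β)).hasDerivWithinAt
        (s := Icc 0 (ξ X₁))
      exact h2.congr_deriv (by simp; ring)
    have hαξ : α * ξ X₁ = 1 + β * ξ X₁ ^ 2 - (X₁ - X₀) ^ 2 := by
      rw [hαdef, div_mul_cancel₀ _ hξ1.ne']
    have hle := (hd.sub hq).nonpos_of_forall_le hξ1 (by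
      intro s hs
      have := hbar (ξ X₁ - s) ⟨by linarith [hs.2], by linarith [hs.1]⟩
      simp [h.2.2.2.2.2.2.2.1 X₁, ← sub_eq_add_neg]
      linarith)
    have hY := (abs_le.1 (h.abs_psi_le_of_surface hK hKR X₁).2).2
    have hξR : β * ξ X₁ ≤ β * R := mul_le_mul_of_nonneg_left (h.surface_le X₁) hβ0.le
    simp at hle
    linarith
  have := h.le_barrier hmono hω hβ (α := K + 2 * β * R) (X₀ := X₀) (by linarith)
    (fun X hX => (hsurf X hX).trans (by
      have := mul_le_mul_of_nonneg_right hαle (h.surface_pos X).le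
      linarith)) hX₀ hz
  nlinarith [mul_nonneg hβ0.le (sq_nonneg Y)]

lemma abs_surface_sub_le (h : IsWaterWave ω Ψ ξ R) {M : ℝ} (hM : ∀ X, |deriv ξ X| ≤ M)
    (X X' : ℝ) : |ξ X - ξ X'| ≤ M * |X - X'| := by
  have := convex_univ.norm_image_sub_le_of_norm_deriv_le (f := ξ) (C := M) (x := X') (y := X)
    (fun x _ => (h.2.1.differentiable one_ne_zero) x) (fun x _ => hM x) (mem_univ _) (mem_univ _)
  simpa using this

end IsWaterWave

/-- The norm on the plane with the horizontal direction stretched by the factor `M + 1`. -/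
noncomputable def stretchedNorm (M a b : ℝ) : ℝ := √((M + 1) ^ 2 * a ^ 2 + b ^ 2)

lemma stretchedNorm_nonneg (M a b : ℝ) : 0 ≤ stretchedNorm M a b := Real.sqrt_nonneg _

lemma stretchedNorm_sq (M a b : ℝ) : stretchedNorm M a b ^ 2 = (M + 1) ^ 2 * a ^ 2 + b ^ 2 :=
  Real.sq_sqrt (by positivity)

lemma stretchedNorm_mul (M a b : ℝ) {t : ℝ} (ht : 0 ≤ t) :
    stretchedNorm M (t * a) (t * b) = t * stretchedNorm M a b := by
  rw [stretchedNorm, show (M + 1) ^ 2 * (t * a) ^ 2 + (t * b) ^ 2 =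
    t ^ 2 * ((M + 1) ^ 2 * a ^ 2 + b ^ 2) by ring, Real.sqrt_mul (sq_nonneg t),
    Real.sqrt_sq ht, stretchedNorm]

lemma stretchedNorm_neg (M a b : ℝ) : stretchedNorm M (-a) (-b) = stretchedNorm M a b := by
  simp [stretchedNorm]

lemma sq_add_sq_le_stretchedNorm_sq {M : ℝ} (hM : 0 ≤ M) (a b : ℝ) :
    a ^ 2 + b ^ 2 ≤ stretchedNorm M a b ^ 2 := by
  rw [stretchedNorm_sq]
  have : 0 ≤ (M ^ 2 + 2 * M) * a ^ 2 := by positivity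
  linarith

lemma abs_le_stretchedNorm_left {M : ℝ} (hM : 0 ≤ M) (a b : ℝ) : |a| ≤ stretchedNorm M a b :=
  abs_le_of_sq_le_sq (by nlinarith [sq_add_sq_le_stretchedNorm_sq hM a b, sq_nonneg b])
    (stretchedNorm_nonneg _ _ _)

lemma abs_le_stretchedNorm_right {M : ℝ} (hM : 0 ≤ M) (a b : ℝ) : |b| ≤ stretchedNorm M a b :=
  abs_le_of_sq_le_sq (by nlinarith [sq_add_sq_le_stretchedNorm_sq hM a b, sq_nonneg a])
    (stretchedNorm_nonneg _ _ _)

lemma stretchedNorm_le_of_slope {M : ℝ} (hM : 0 ≤ M) {a b : ℝ} (hb : -(M * |a|) ≤ b) :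
    stretchedNorm M a b ≤ 2 * ((M + 1) ^ 2 * |a| + (M + 1) * b) := by
  set u := (M + 1) * |a| with hu
  have ha := abs_nonneg a
  have hu0 : 0 ≤ u := by positivity
  have hub : |a| ≤ u + b := by rw [hu]; linarith
  have e : (M + 1) ^ 2 * |a| + (M + 1) * b = (M + 1) * (u + b) := by rw [hu]; ring
  have h1 : u + b ≤ (M + 1) * (u + b) := by nlinarith
  have h2 : u ≤ (M + 1) * (u + b) := by
    rw [hu]; exact mul_le_mul_of_nonneg_left hub (by linarith)
  rw [e]
  set T := (M + 1) * (u + b)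
  refine Real.sqrt_le_iff.2 ⟨by linarith, ?_⟩
  have e2 : (M + 1) ^ 2 * a ^ 2 = u ^ 2 := by rw [hu, mul_pow, sq_abs]
  rw [e2]
  rcases le_total 0 b with h0 | h0
  · nlinarith
  · have : -b ≤ u := by linarith
    nlinarith

lemma continuous_stretchedNorm (M : ℝ) :
    Continuous (fun p : (ℝ × ℝ) × (ℝ × ℝ) => stretchedNorm M (p.1.1 - p.2.1) (p.1.2 - p.2.2)) := by
  unfold stretchedNorm
  fun_prop

lemma psiSecond_neg (ξ : ℝ → ℝ) (Ψ : ℝ × ℝ → ℝ) (z : ℝ × ℝ) (a b : ℝ) :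
    psiSecond ξ Ψ z (-a, -b) = psiSecond ξ Ψ z (a, b) := by
  have : ((-a, -b) : ℝ × ℝ) = -(a, b) := rfl
  unfold psiSecond
  rw [this, map_neg, map_neg]
  simp

/-- The doubled function whose maximum is examined in the two-point estimate. -/
noncomputable def doubledGap (Ψ : ℝ × ℝ → ℝ) (M L X₀ : ℝ) (z w : ℝ × ℝ) : ℝ :=
  Ψ z - Ψ w - (L * (stretchedNorm M (z.1 - w.1) (z.2 - w.2)
    - stretchedNorm M (z.1 - w.1) (z.2 - w.2) ^ 2 / 4) + (z.1 - X₀) ^ 2)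

namespace IsWaterWave

variable {ω : ℝ → ℝ} {Ψ : ℝ × ℝ → ℝ} {ξ : ℝ → ℝ} {R : ℝ}

/-- The doubled function has no interior local maximum. -/
lemma not_isLocalMax_doubledGap (h : IsWaterWave ω Ψ ξ R)
    (hmono : ∀ z ∈ fluidDomain ξ, 0 ≤ psiY ξ Ψ z)
    {ω₁ M L X₀ : ℝ} (hω : ∀ τ ∈ Icc (0:ℝ) 1, |ω τ| ≤ ω₁) (hM : 0 ≤ M) (hL : ω₁ + 1 < L)
    {z w : ℝ × ℝ} (hz : z ∈ fluidDomain ξ) (hw : w ∈ fluidDomain ξ)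
    (hzw : 0 < stretchedNorm M (z.1 - w.1) (z.2 - w.2))
    (hmax : IsLocalMax (fun p : (ℝ × ℝ) × (ℝ × ℝ) => doubledGap Ψ M L X₀ p.1 p.2) (z, w)) :
    False := by
  obtain ⟨x, y⟩ := z
  obtain ⟨x', y'⟩ := w
  simp only at hzw
  set a := x - x' with ha
  set b := y - y' with hb
  set r := stretchedNorm M a b with hr
  have hω₁ : 0 ≤ ω₁ := (abs_nonneg _).trans (hω 0 (by simp))
  have hline : ∀ d e : ℝ × ℝ, ∀ᶠ s in 𝓝 (0:ℝ),
      doubledGap Ψ M L X₀ ((x, y) + s • d) ((x', y') + s • e)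
        ≤ doubledGap Ψ M L X₀ (x, y) (x', y') := by
    intro d e
    have hc : Continuous (fun s : ℝ => (((x, y) + s • d, (x', y') + s • e) :
      (ℝ × ℝ) × (ℝ × ℝ))) := by fun_prop
    have h0 := hc.tendsto 0
    simp only [zero_smul, add_zero] at h0
    exact h0.eventually hmax
  have e1 : psiSecond ξ Ψ (x, y) (a, b) - psiSecond ξ Ψ (x', y') (-a, -b)
      - 2 * (a ^ 2 - L * r ^ 2) ≤ 0 := by
    refine (((h.hasSecondDerivAtZero hz (a, b)).sub (h.hasSecondDerivAtZero hw (-a, -b))).sub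
      (hasSecondDerivAtZero_quadratic (L * (r - r ^ 2 / 4) + (x - X₀) ^ 2)
        (L * (2 * r - r ^ 2) + 2 * a * (x - X₀)) (a ^ 2 - L * r ^ 2))).nonpos ?_
    filter_upwards [hline (a, b) (-a, -b), Ioi_mem_nhds (show (-1/2 : ℝ) < 0 by norm_num)]
      with s hs hs2
    have hs3 : 0 ≤ 1 + 2 * s := by
      have : -1 / 2 < s := hs2
      linarith
    have hN : stretchedNorm M (x + s * a - (x' + -(s * a))) (y + s * b - (y' + -(s * b)))
        = (1 + 2 * s) * r := by
      rw [hr, ← stretchedNorm_mul _ _ _ hs3]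
      congr 1
      · rw [ha]; ring
      · rw [hb]; ring
    simp only [doubledGap, Prod.fst_add, Prod.snd_add, Prod.smul_fst, Prod.smul_snd, smul_eq_mul,
      mul_neg, hN, ← ha, ← hb, ← hr] at hs
    simp only [zero_smul, add_zero, mul_zero, ne_eq, OfNat.ofNat_ne_zero, not_false_eq_true,
      zero_pow]
    linarith
  have e2 : psiSecond ξ Ψ (x, y) (-b, a) - psiSecond ξ Ψ (x', y') (-b, a) - 2 * b ^ 2 ≤ 0 := by
    refine (((h.hasSecondDerivAtZero hz (-b, a)).sub (h.hasSecondDerivAtZero hw (-b, a))).sub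
      (hasSecondDerivAtZero_quadratic (L * (r - r ^ 2 / 4) + (x - X₀) ^ 2)
        (-2 * b * (x - X₀)) (b ^ 2))).nonpos ?_
    filter_upwards [hline (-b, a) (-b, a)] with s hs
    have hN : stretchedNorm M (x + -(s * b) - (x' + -(s * b))) (y + s * a - (y' + s * a)) = r := by
      rw [hr]
      congr 1
      · rw [ha]; ring
      · rw [hb]; ring
    simp only [doubledGap, Prod.fst_add, Prod.snd_add, Prod.smul_fst, Prod.smul_snd, smul_eq_mul,
      mul_neg, hN, ← ha, ← hb, ← hr] at hs
    simp only [zero_smul, add_zero, mul_zero, ne_eq, OfNat.ofNat_ne_zero, not_false_eq_true,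
      zero_pow]
    linarith
  rw [psiSecond_neg] at e1
  have e3 := h.psiSecond_add hz a b
  have e4 := h.psiSecond_add hw a b
  have b1 := abs_le.1 (hω _ (h.psi_mem_Icc hmono (subset_closure hz)))
  have b2 := abs_le.1 (hω _ (h.psi_mem_Icc hmono (subset_closure hw)))
  have hab : a ^ 2 + b ^ 2 ≤ r ^ 2 := sq_add_sq_le_stretchedNorm_sq hM a b
  have hab0 : 0 ≤ a ^ 2 + b ^ 2 := by positivity
  have hr2 : 0 < r ^ 2 := by positivity
  have m1 := mul_le_mul_of_nonneg_left b1.2 hab0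
  have m2 := mul_le_mul_of_nonneg_left b2.1 hab0
  have m3 := mul_le_mul_of_nonneg_left hab (show 0 ≤ ω₁ + 1 by linarith)
  have m4 := mul_lt_mul_of_pos_right hL hr2
  linarith

/-- The doubled function is not maximal when its first point lies on the free surface. -/
lemma exists_doubledGap_lt_of_surface (h : IsWaterWave ω Ψ ξ R) {K M L X₀ : ℝ} (hK : 0 ≤ K)
    (hKR : 2 * R ≤ K ^ 2) (hM : 0 ≤ M) (hslope : ∀ X, |deriv ξ X| ≤ M)
    (hL : 4 * (K * (M + 2) + 2) < L) {x : ℝ} {w : ℝ × ℝ} (hw : w ∈ closure (fluidDomain ξ))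
    (hzw : 0 < stretchedNorm M (x - w.1) (ξ x - w.2))
    (hzw1 : stretchedNorm M (x - w.1) (ξ x - w.2) < 1)
    (hx : |x - X₀| < 1) :
    ∃ z ∈ closure (fluidDomain ξ), stretchedNorm M (z.1 - w.1) (z.2 - w.2) ≤ 1 ∧
      |z.1 - X₀| ≤ 1 ∧ doubledGap Ψ M L X₀ (x, ξ x) w < doubledGap Ψ M L X₀ z w := by
  by_contra! hcon
  obtain ⟨x', y'⟩ := w
  simp only at hzw hzw1 hcon
  set a := x - x' with ha
  set b := ξ x - y' with hb
  set r := stretchedNorm M a b with hr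
  obtain ⟨σ, hσ, hσa⟩ : ∃ σ : ℝ, |σ| = 1 ∧ a * σ = |a| := by
    rcases le_total 0 a with h0 | h0
    · exact ⟨1, by simp, by simp [abs_of_nonneg h0]⟩
    · exact ⟨-1, by simp, by simp [abs_of_nonpos h0]⟩
  have hw' := h.mem_closure_iff.1 hw
  simp only at hw'
  have hslope_b : -(M * |a|) ≤ b := by
    have := (abs_le.1 (h.abs_surface_sub_le hslope x x')).1
    rw [hb]; linarith [hw'.2]
  have hq := stretchedNorm_le_of_slope hM hslope_b
  rw [← hr] at hq
  set d : ℝ × ℝ := (-σ, -(M + 1)) with hd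
  have hξ := h.surface_pos x
  have hev : ∀ᶠ s in 𝓝 (0:ℝ), s < ξ x / (M + 1) ∧
      stretchedNorm M (a + s * (-σ)) (b + s * (-(M + 1))) < 1 ∧ |x + s * (-σ) - X₀| < 1 := by
    refine (eventually_lt_nhds (by positivity)).and (Eventually.and ?_ ?_)
    · have hc : Continuous (fun s : ℝ => stretchedNorm M (a + s * (-σ)) (b + s * (-(M + 1)))) := by
        unfold stretchedNorm; fun_prop
      exact hc.continuousAt.eventually_lt continuousAt_const (by simpa using hzw1)
    · have hc : Continuous (fun s : ℝ => |x + s * (-σ) - X₀|) := by fun_prop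
      exact hc.continuousAt.eventually_lt continuousAt_const (by simpa using hx)
  obtain ⟨ε, hε, hball⟩ := Metric.eventually_nhds_iff.1 hev
  have hδ : 0 < ε / 2 := by linarith
  have hgood := fun s (hs : s ∈ Icc 0 (ε / 2)) =>
    hball (y := s) (by rw [Real.dist_eq, sub_zero, abs_of_nonneg hs.1]; linarith [hs.2])
  have hmem : ∀ s ∈ Icc 0 (ε / 2), (x, ξ x) + s • d ∈ closure (fluidDomain ξ) := by
    intro s hs
    rw [h.mem_closure_iff]
    have h1 := (hgood s hs).1
    rw [lt_div_iff₀ (by linarith)] at h1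
    have h2 := (abs_le.1 (h.abs_surface_sub_le hslope (x + s * (-σ)) x)).1
    rw [add_sub_cancel_left, abs_mul, abs_neg, hσ, abs_of_nonneg hs.1] at h2
    simp only [hd, Prod.fst_add, Prod.snd_add, Prod.smul_fst, Prod.smul_snd, smul_eq_mul]
    constructor
    · linarith
    · linarith [hs.1]
  have hΨ := h.hasDerivWithinAt_line (t := 0) (left_mem_Icc.2 hδ.le) hmem
  have hN : HasDerivAt (fun s : ℝ => stretchedNorm M (a + s * (-σ)) (b + s * (-(M + 1))))
      (-((M + 1) ^ 2 * |a| + (M + 1) * b) / r) 0 := by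
    have h1 : HasDerivAt (fun s : ℝ => a + s * (-σ)) (-σ) 0 := by
      simpa using ((hasDerivAt_id (0:ℝ)).mul_const (-σ)).const_add a
    have h2 : HasDerivAt (fun s : ℝ => b + s * (-(M + 1))) (-(M + 1)) 0 := by
      simpa using ((hasDerivAt_id (0:ℝ)).mul_const (-(M + 1))).const_add b
    have h3 := ((h1.pow 2).const_mul ((M + 1) ^ 2)).add (h2.pow 2)
    have h4 := h3.sqrt (by
      have := stretchedNorm_sq M a b
      rw [← hr] at this
      simp
      rw [← this]
      positivity)
    refine h4.congr_deriv ?_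
    have h5 : √((M + 1) ^ 2 * a ^ 2 + b ^ 2) = r := rfl
    simp [h5, ← hσa]
    field_simp
    ring
  have hpen : HasDerivAt (fun s : ℝ => (x + s * (-σ) - X₀) ^ 2) (-(2 * (x - X₀) * σ)) 0 := by
    have h1 : HasDerivAt (fun s : ℝ => x + s * (-σ) - X₀) (-σ) 0 := by
      simpa using (((hasDerivAt_id (0:ℝ)).mul_const (-σ)).const_add x).sub_const X₀
    refine (h1.pow 2).congr_deriv ?_
    simp
  have htot := (hΨ.sub_const (Ψ (x', y'))).sub
    (((hN.sub ((hN.pow 2).div_const 4)).const_mul L).add hpen).hasDerivWithinAt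
  have hle := htot.nonpos_of_forall_le hδ (by
    intro s hs
    have h1 := hcon _ (hmem s hs)
    have e1 : x + s * (-σ) - x' = a + s * (-σ) := by rw [ha]; ring
    have e2 : ξ x + s * (-(M + 1)) - y' = b + s * (-(M + 1)) := by rw [hb]; ring
    simp only [hd, doubledGap, Prod.fst_add, Prod.snd_add, Prod.smul_fst, Prod.smul_snd,
      smul_eq_mul, e1, e2, ← ha, ← hb] at h1
    have h2 := h1 (hgood s hs).2.1.le (hgood s hs).2.2.le
    simpa [hd] using h2)
  have hr0 : stretchedNorm M (a + 0 * (-σ)) (b + 0 * (-(M + 1))) = r := by simp [hr]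
  simp only [hd, hr0, zero_smul, add_zero] at hle
  obtain ⟨kx, ky⟩ := h.abs_psi_le_of_surface hK hKR x
  set q := ((M + 1) ^ 2 * |a| + (M + 1) * b) / r with hqdef
  have hq2 : 1 / 2 ≤ q := by
    rw [hqdef, le_div_iff₀ hzw]; linarith
  have eq1 : -((M + 1) ^ 2 * |a| + (M + 1) * b) / r = -q := by rw [hqdef]; ring
  rw [eq1] at hle
  have hpx : psiX ξ Ψ (x, ξ x) * σ ≤ K := by
    refine (le_abs_self _).trans ?_
    rw [abs_mul, hσ, mul_one]; exact kx
  have hpy : psiY ξ Ψ (x, ξ x) * (M + 1) ≤ K * (M + 1) :=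
    mul_le_mul_of_nonneg_right ((le_abs_self _).trans ky) (by linarith)
  have hpp : -1 ≤ (x - X₀) * σ := by
    refine (abs_le.1 ?_).1
    rw [abs_mul, hσ, mul_one]; exact hx.le
  have hLq : 1 / 4 ≤ q * (1 - r / 2) := by nlinarith
  have hL0 : 0 ≤ L := by
    have : 0 ≤ K * (M + 2) := by positivity
    linarith
  have hLL := mul_le_mul_of_nonneg_left hLq hL0
  norm_num at hle
  nlinarith

/-- Lipschitz bound for `Ψ` between two nearby points of the closed fluid domain. -/
lemma sub_le_stretchedNorm (h : IsWaterWave ω Ψ ξ R)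
    (hmono : ∀ z ∈ fluidDomain ξ, 0 ≤ psiY ξ Ψ z) {ω₁ K M L β : ℝ}
    (hω : ∀ τ ∈ Icc (0:ℝ) 1, |ω τ| ≤ ω₁) (hK : 0 ≤ K)
    (hKR : 2 * R ≤ K ^ 2) (hM : 0 ≤ M) (hslope : ∀ X, |deriv ξ X| ≤ M)
    (hβ : ω₁ + 2 < 2 * β) (hL : 4 * (K * (M + 2) + 2) < L) (hLω : ω₁ + 1 < L)
    (hLβ : 4 * (K + 2 * β * R) ≤ 3 * L) {z₀ w₀ : ℝ × ℝ}
    (hz₀ : z₀ ∈ closure (fluidDomain ξ)) (hw₀ : w₀ ∈ closure (fluidDomain ξ))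
    (hzw₀ : stretchedNorm M (z₀.1 - w₀.1) (z₀.2 - w₀.2) ≤ 1) :
    Ψ z₀ - Ψ w₀ ≤ L * stretchedNorm M (z₀.1 - w₀.1) (z₀.2 - w₀.2) := by
  obtain ⟨X₀, Y₀⟩ := z₀
  set N : (ℝ × ℝ) × (ℝ × ℝ) → ℝ := fun p => stretchedNorm M (p.1.1 - p.2.1) (p.1.2 - p.2.2)
    with hNdef
  have hNc : Continuous N := continuous_stretchedNorm M
  have hL8 : 8 < L := by
    have : 0 ≤ K * (M + 2) := by positivity
    linarith
  set S : Set ((ℝ × ℝ) × (ℝ × ℝ)) := closure (fluidDomain ξ) ×ˢ closure (fluidDomain ξ) ∩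
    {p | N p ≤ 1 ∧ |p.1.1 - X₀| ≤ 1} with hS
  have hSc : IsCompact S := by
    refine (isCompact_Icc (a := ((X₀ - 1, (0:ℝ)), (X₀ - 2, (0:ℝ))))
      (b := ((X₀ + 1, R), (X₀ + 2, R)))).of_isClosed_subset
      ((isClosed_closure.prod isClosed_closure).inter
        ((isClosed_le hNc continuous_const).inter
          (isClosed_le (f := fun p : (ℝ × ℝ) × (ℝ × ℝ) => |p.1.1 - X₀|) (by fun_prop)
            continuous_const))) ?_
    rintro ⟨⟨x, y⟩, ⟨x', y'⟩⟩ ⟨⟨h1, h2⟩, h3, h4⟩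
    rw [h.mem_closure_iff] at h1 h2
    simp only at h1 h2 h4
    have h5 := abs_le.1 ((abs_le_stretchedNorm_left hM (x - x') (y - y')).trans h3)
    have h6 := abs_le.1 h4
    exact ⟨⟨⟨by linarith, h1.1⟩, ⟨by linarith, h2.1⟩⟩,
      ⟨⟨by linarith, h1.2.trans (h.surface_le x)⟩, ⟨by linarith, h2.2.trans (h.surface_le x')⟩⟩⟩
  have hmem₀ : ((X₀, Y₀), w₀) ∈ S := ⟨⟨hz₀, hw₀⟩, hzw₀, by simp⟩
  have hcont : ContinuousOn (fun p : (ℝ × ℝ) × (ℝ × ℝ) => doubledGap Ψ M L X₀ p.1 p.2) S := by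
    have hΨ := h.2.2.2.1.continuousOn
    unfold doubledGap
    refine ((hΨ.comp continuousOn_fst fun p hp => hp.1.1).sub
      (hΨ.comp continuousOn_snd fun p hp => hp.1.2)).sub (Continuous.continuousOn ?_)
    exact (continuous_const.mul (hNc.sub ((hNc.pow 2).div_const 4))).add (by fun_prop)
  obtain ⟨⟨⟨x, y⟩, ⟨x', y'⟩⟩, hp, hpmax⟩ := hSc.exists_isMaxOn ⟨_, hmem₀⟩ hcont
  rw [isMaxOn_iff] at hpmax
  suffices hgap : doubledGap Ψ M L X₀ (x, y) (x', y') ≤ 0 by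
    have h1 := (hpmax _ hmem₀).trans hgap
    simp only [doubledGap, sub_self] at h1
    have := mul_nonneg (show 0 ≤ L by linarith)
      (sq_nonneg (stretchedNorm M (X₀ - w₀.1) (Y₀ - w₀.2)))
    simp only
    linarith
  by_contra! hpos
  obtain ⟨⟨hz, hw⟩, hN1, hx1⟩ := hp
  simp only at hz hw hx1
  have hΨz := h.psi_mem_Icc hmono hz
  have hΨw := h.psi_mem_Icc hmono hw
  have hz' := h.mem_closure_iff.1 hz
  have hw' := h.mem_closure_iff.1 hw
  simp only at hz' hw'
  set r := stretchedNorm M (x - x') (y - y') with hr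
  have hN1' : r ≤ 1 := hN1
  have hr0 : 0 ≤ r := stretchedNorm_nonneg _ _ _
  have hgapdef : doubledGap Ψ M L X₀ (x, y) (x', y') =
      Ψ (x, y) - Ψ (x', y') - (L * (r - r ^ 2 / 4) + (x - X₀) ^ 2) := rfl
  rw [hgapdef] at hpos
  have hLr : L * (3 / 4 * r) ≤ L * (r - r ^ 2 / 4) :=
    mul_le_mul_of_nonneg_left (by nlinarith) (by linarith)
  have hLr0 : 0 ≤ L * (3 / 4 * r) := mul_nonneg (by linarith) (by linarith)
  have hsq := sq_nonneg (x - X₀)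
  have hrpos : 0 < r := by
    refine lt_of_le_of_ne hr0 fun h0 => ?_
    have h1 := sq_add_sq_le_stretchedNorm_sq hM (x - x') (y - y')
    rw [← hr, ← h0] at h1
    have hx : x = x' := by nlinarith [sq_nonneg (x - x'), sq_nonneg (y - y')]
    have hy : y = y' := by nlinarith [sq_nonneg (x - x'), sq_nonneg (y - y')]
    subst hx hy
    linarith
  have hr1 : r < 1 := by
    refine lt_of_le_of_ne hN1' fun h0 => ?_
    rw [h0] at hLr hpos
    linarith [hΨz.2, hΨw.1]
  have hx1' : |x - X₀| < 1 := by
    refine lt_of_le_of_ne hx1 fun h0 => ?_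
    have : (x - X₀) ^ 2 = 1 := by rw [← sq_abs, h0]; norm_num
    linarith [hΨz.2, hΨw.1]
  have hy0 : 0 < y := by
    refine lt_of_le_of_ne hz'.1 fun h0 => ?_
    have := h.2.2.2.2.2.2.2.2 x
    rw [h0] at this
    linarith [hΨw.1]
  have hy'0 : 0 < y' := by
    refine lt_of_le_of_ne hw'.1 fun h0 => ?_
    have h1 := h.2.2.2.2.2.2.2.2 x'
    rw [h0] at h1
    have h2 := h.le_linear hmono hω hK hKR hβ hz
    have h3 := (le_abs_self _).trans (abs_le_stretchedNorm_right hM (x - x') (y - y'))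
    rw [← hr, ← h0, sub_zero] at h3
    have h4 := mul_le_mul_of_nonneg_right hLβ hy0.le
    have h5 := mul_le_mul_of_nonneg_left h3 (show 0 ≤ L by linarith)
    simp only at h2
    linarith
  have hy'1 : y' < ξ x' := by
    refine lt_of_le_of_ne hw'.2 fun h0 => ?_
    have := h.2.2.2.2.2.2.2.1 x'
    rw [← h0] at this
    linarith [hΨz.2]
  have hy1 : y < ξ x := by
    refine lt_of_le_of_ne hz'.2 fun h0 => ?_
    subst h0
    obtain ⟨v, hv, hv1, hv2, hv3⟩ := h.exists_doubledGap_lt_of_surface hK hKR hM hslope hL hw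
      hrpos hr1 hx1'
    exact absurd (hpmax (v, (x', y')) ⟨⟨hv, hw⟩, hv1, hv2⟩) (not_le.2 hv3)
  refine h.not_isLocalMax_doubledGap hmono hω hM hLω (z := (x, y)) (w := (x', y'))
    ⟨hy0, hy1⟩ ⟨hy'0, hy'1⟩ hrpos (X₀ := X₀) ?_
  have hopen := isOpen_fluidDomain h.continuous_surface
  have hSn : S ∈ 𝓝 (((x, y), (x', y')) : (ℝ × ℝ) × (ℝ × ℝ)) := by
    have n1 : ∀ᶠ p in 𝓝 (((x, y), (x', y')) : (ℝ × ℝ) × (ℝ × ℝ)), N p < 1 :=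
      hNc.continuousAt.eventually_lt continuousAt_const hr1
    have n2 : ∀ᶠ p in 𝓝 (((x, y), (x', y')) : (ℝ × ℝ) × (ℝ × ℝ)), |p.1.1 - X₀| < 1 :=
      (show Continuous fun p : (ℝ × ℝ) × (ℝ × ℝ) => |p.1.1 - X₀| by
        fun_prop).continuousAt.eventually_lt continuousAt_const hx1'
    filter_upwards [n1, n2, (hopen.prod hopen).mem_nhds
      (show ((x, y), (x', y')) ∈ fluidDomain ξ ×ˢ fluidDomain ξ from
        ⟨⟨hy0, hy1⟩, ⟨hy'0, hy'1⟩⟩)] with p h1 h2 h3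
    exact ⟨⟨subset_closure h3.1, subset_closure h3.2⟩, h1.le, h2.le⟩
  filter_upwards [hSn] with p hp using hpmax p hp

/-- Directional derivative bound obtained from a Lipschitz bound along a segment. -/
lemma abs_directional_le (h : IsWaterWave ω Ψ ξ R) {M L : ℝ}
    (hlip : ∀ z ∈ closure (fluidDomain ξ), ∀ w ∈ closure (fluidDomain ξ),
      stretchedNorm M (z.1 - w.1) (z.2 - w.2) ≤ 1 →
      Ψ z - Ψ w ≤ L * stretchedNorm M (z.1 - w.1) (z.2 - w.2))
    {z d : ℝ × ℝ} {δ : ℝ} (hδ : 0 < δ) (hδ1 : δ * stretchedNorm M d.1 d.2 ≤ 1)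
    (hmem : ∀ s ∈ Icc 0 δ, z + s • d ∈ closure (fluidDomain ξ)) :
    |psiX ξ Ψ z * d.1 + psiY ξ Ψ z * d.2| ≤ L * stretchedNorm M d.1 d.2 := by
  set n := stretchedNorm M d.1 d.2 with hn
  have hz : z ∈ closure (fluidDomain ξ) := by simpa using hmem 0 ⟨le_rfl, hδ.le⟩
  have hd := h.hasDerivWithinAt_line (t := 0) (left_mem_Icc.2 hδ.le) hmem
  simp only [zero_smul, add_zero] at hd
  have hlin : HasDerivWithinAt (fun s : ℝ => s * (L * n)) (L * n) (Icc 0 δ) 0 := by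
    simpa using ((hasDerivAt_id (0:ℝ)).mul_const (L * n)).hasDerivWithinAt (s := Icc 0 δ)
  have hN : ∀ s ∈ Icc 0 δ, stretchedNorm M (s * d.1) (s * d.2) = s * n ∧ s * n ≤ 1 := fun s hs =>
    ⟨stretchedNorm_mul _ _ _ hs.1,
      (mul_le_mul_of_nonneg_right hs.2 (stretchedNorm_nonneg _ _ _)).trans hδ1⟩
  have h1 := (hd.sub hlin).nonpos_of_forall_le hδ (by
    intro s hs
    obtain ⟨e1, e2⟩ := hN s hs
    have := hlip _ (hmem s hs) z hz
    simp only [Prod.fst_add, Prod.snd_add, Prod.smul_fst, Prod.smul_snd, smul_eq_mul,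
      add_sub_cancel_left, e1] at this
    have := this e2
    simp
    linarith)
  have h2 := (hd.neg.sub hlin).nonpos_of_forall_le hδ (by
    intro s hs
    obtain ⟨e1, e2⟩ := hN s hs
    have := hlip z hz _ (hmem s hs)
    simp only [Prod.fst_add, Prod.snd_add, Prod.smul_fst, Prod.smul_snd, smul_eq_mul,
      sub_add_cancel_left, stretchedNorm_neg, e1] at this
    have := this e2
    simp
    linarith)
  rw [abs_le]
  constructor <;> linarith

end IsWaterWave

/-- uniform gradient bound. For fixed `R₁`, `M ≥ 0` and `ω₁` there is a constant
`C = C(R₁, M, ω₁)`, depending on no other parameters, such that any unidirectional solution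
`(Ψ, ξ, R)` of the water-wave problem with vorticity bounded by `ω₁`, `R_c < R ≤ R₁`, `Ψ_Y ≥ 0`
in `D_ξ` and `|ξ′| ≤ M` satisfies `|∇Ψ| ≤ C` on the closure of `D_ξ`. -/
theorem stmt14 (R₁ M ω₁ : ℝ) (hM : 0 ≤ M) :
    ∃ C : ℝ, ∀ (ω : ℝ → ℝ) (Ψ : ℝ × ℝ → ℝ) (ξ : ℝ → ℝ) (R : ℝ),
      IsWaterWave ω Ψ ξ R →
      sSup ((fun τ => |ω τ|) '' Set.Icc 0 1)
        + sSup ((fun τ => |derivWithin ω (Set.Icc 0 1) τ|) '' Set.Icc 0 1) ≤ ω₁ →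
      Rc ω < R → R ≤ R₁ →
      (∀ z ∈ fluidDomain ξ, 0 ≤ psiY ξ Ψ z) →
      (∀ X : ℝ, |deriv ξ X| ≤ M) →
      ∀ z ∈ closure (fluidDomain ξ),
        Real.sqrt ((psiX ξ Ψ z) ^ 2 + (psiY ξ Ψ z) ^ 2) ≤ C := by
  set K : ℝ := 2 * |R₁| + 1 with hKdef
  set β : ℝ := ω₁ / 2 + 2 with hβdef
  set L : ℝ := 2 * (K + 2 * |β| * |R₁|) + 4 * (K * (M + 2) + 2) + |ω₁| + 2 with hLdef
  refine ⟨2 * (L * (M + 1) + K), fun ω Ψ ξ R h hω _ hRR hmono hslope z hz => ?_⟩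
  have hK : 0 ≤ K := by positivity
  have hL : 0 ≤ L := by positivity
  have hω' := fun τ (hτ : τ ∈ Icc (0:ℝ) 1) => h.abs_vorticity_le hω hτ
  have hω₁ : 0 ≤ ω₁ := (abs_nonneg _).trans (hω' 0 (by simp))
  have hβ : 0 ≤ β := by positivity
  have hR : 0 < R := (h.surface_pos 0).trans_le (h.surface_le 0)
  have hKR : 2 * R ≤ K ^ 2 := by
    have := le_abs_self R₁
    nlinarith [abs_nonneg R₁]
  have hKM : 0 ≤ K * (M + 2) := by positivity
  have hβR : β * R ≤ |β| * |R₁| :=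
    mul_le_mul (le_abs_self _) (hRR.trans (le_abs_self _)) hR.le (abs_nonneg _)
  have hβR₁ : 0 ≤ |β| * |R₁| := by positivity
  have hlip := fun z hz w hw => h.sub_le_stretchedNorm hmono (L := L) (z₀ := z) (w₀ := w) hω' hK
    hKR hM hslope (show ω₁ + 2 < 2 * β by rw [hβdef]; linarith)
    (by rw [hLdef]; linarith [abs_nonneg ω₁])
    (by rw [hLdef]; linarith [le_abs_self ω₁])
    (by rw [hLdef]; linarith [abs_nonneg ω₁]) hz hw
  obtain ⟨x, y⟩ := z
  have hz' := h.mem_closure_iff.1 hz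
  simp only at hz'
  have hLM : L ≤ L * (M + 1) := le_mul_of_one_le_right hL (by linarith)
  have hbound : |psiX ξ Ψ (x, y)| ≤ L * (M + 1) + K ∧ |psiY ξ Ψ (x, y)| ≤ L * (M + 1) + K := by
    rcases hz'.2.lt_or_eq with hlt | heq
    · have n1 : stretchedNorm M 1 0 = M + 1 := by
        simp [stretchedNorm, Real.sqrt_sq (show 0 ≤ M + 1 by linarith)]
      have n2 : stretchedNorm M 0 1 = 1 := by simp [stretchedNorm]
      constructor
      · have hev : ∀ᶠ s in 𝓝 (0:ℝ), y < ξ (x + s) := by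
          have hc : Continuous fun s : ℝ => ξ (x + s) := h.continuous_surface.comp (by fun_prop)
          exact continuousAt_const.eventually_lt hc.continuousAt (by simpa using hlt)
        obtain ⟨ε, hε, hball⟩ := Metric.eventually_nhds_iff.1 hev
        have hM1 : 0 < M + 1 := by linarith
        have := h.abs_directional_le hlip (z := (x, y)) (d := (1, 0))
          (δ := min (ε / 2) (1 / (M + 1))) (by positivity)
          (by rw [n1, ← le_div_iff₀ hM1]; exact min_le_right _ _)
          (fun s hs => by
            rw [h.mem_closure_iff]
            have h1 : dist s 0 < ε := by
              rw [Real.dist_eq, sub_zero, abs_of_nonneg hs.1]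
              linarith [hs.2.trans (min_le_left _ _)]
            simpa using ⟨hz'.1, (hball h1).le⟩)
        simp only [n1, mul_one, mul_zero, add_zero] at this
        linarith
      · have hgap : 0 < ξ x - y := by linarith
        have := h.abs_directional_le hlip (z := (x, y)) (d := (0, 1))
          (δ := min (ξ x - y) 1) (by positivity)
          (by rw [n2, mul_one]; exact min_le_right _ _)
          (fun s hs => by
            rw [h.mem_closure_iff]
            have h1 := hs.2.trans (min_le_left _ _)
            have h2 := hs.1
            simp
            constructor <;> linarith [hz'.1])
        simp only [n2, mul_one, mul_zero, zero_add] at this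
        linarith
    · obtain ⟨k1, k2⟩ := h.abs_psi_le_of_surface hK hKR x
      rw [heq]
      constructor <;> linarith
  set B := L * (M + 1) + K with hB
  have hB0 : 0 ≤ B := (abs_nonneg _).trans hbound.1
  refine Real.sqrt_le_iff.2 ⟨by linarith, ?_⟩
  have s1 := sq_le_sq' (abs_le.1 hbound.1).1 (abs_le.1 hbound.1).2
  have s2 := sq_le_sq' (abs_le.1 hbound.2).1 (abs_le.1 hbound.2).2
  nlinarith [sq_nonneg B]
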